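/- arXiv:2409.05534 — 6 statements merged into one kernel-verified Lean document; each statement's English description precedes it below -/
import Mathlib

section
/- Let F be a field and σ : F → F a field automorphism of finite order m. Let n ≤ m, let h = (h_1, …, h_n) ∈ F^n have entries linearly independent over the fixed field F^σ, and let C ⊆ F^n be any set of vectors. Suppose there exist integers δ ≥ 2, r ≥ 0, b, t1, t2 with gcd(m, t1) = 1 and gcd(m, t2) < δ such that every integer of the form b + t1·i + t2·j with 0 ≤ i ≤ δ−2 and 0 ≤ j ≤ r belongs to the h-defining set T_h^σ(C). Then any two distinct elements of C are at rank distance at least δ + r; in particular they are at Hamming distance at least δ + r. -/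
/-- The fixed subfield of a field automorphism `σ : F ≃+* F`. -/
def fixedField {F : Type*} [Field F] (σ : F ≃+* F) : Subfield F where
  carrier := {x | σ x = x}
  mul_mem' := by
    intro a b ha hb
    simp only [Set.mem_setOf_eq] at *
    rw [map_mul, ha, hb]
  one_mem' := by simp only [Set.mem_setOf_eq, map_one]
  add_mem' := by
    intro a b ha hb
    simp only [Set.mem_setOf_eq] at *
    rw [map_add, ha, hb]
  zero_mem' := by simp only [Set.mem_setOf_eq, map_zero]
  neg_mem' := by
    intro a ha
    simp only [Set.mem_setOf_eq] at *
    rw [map_neg, ha]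
  inv_mem' := by
    intro a ha
    simp only [Set.mem_setOf_eq] at *
    rw [map_inv₀, ha]

/-- The rank weight of a vector: the dimension over the fixed field `F^σ` of the
`F^σ`-span of its entries. -/
noncomputable def rankWeight {F : Type*} [Field F] (σ : F ≃+* F) {n : ℕ} (v : Fin n → F) : ℕ :=
  Module.finrank (fixedField σ) (Submodule.span (fixedField σ) (Set.range v))

/-- The `h`-defining set of a set of vectors `C ⊆ F^n` with respect to `σ`. -/
def definingSet {F : Type*} [Field F] (σ : F ≃+* F) {n : ℕ} (h : Fin n → F)
    (C : Set (Fin n → F)) : Set ℤ :=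
  {i : ℤ | ∀ c ∈ C, ∑ j, c j * (σ ^ i) (h j) = 0}

section RankMetric

variable {F : Type*} [Field F]

lemma zpow_apply_eq_self {τ : F ≃+* F} {a : F} (ha : τ a = a) (z : ℤ) : (τ ^ z) a = a :=
  zpow_mem (K := MulAction.stabilizer (RingAut F) a) (x := τ) ha z

lemma zpow_add_apply (σ : F ≃+* F) (i j : ℤ) (a : F) :
    (σ ^ (i + j)) a = (σ ^ i) ((σ ^ j) a) := by
  rw [zpow_add, RingAut.mul_apply]

/-- An automorphism fixing `a` under its `t`-th power fixes `a` under every power divisible by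
the gcd of `t` and the order. -/
lemma zpow_gcd_mul_apply_eq_self {σ : F ≃+* F} {t : ℤ} {a : F} (ha : (σ ^ t) a = a) (q : ℤ) :
    (σ ^ ((Int.gcd (orderOf σ) t : ℤ) * q)) a = a := by
  rw [zpow_mul]
  refine zpow_apply_eq_self ?_ q
  rw [Int.gcd_eq_gcd_ab, zpow_add_apply, zpow_mul σ t, zpow_apply_eq_self ha, zpow_mul,
    zpow_natCast, pow_orderOf_eq_one, one_zpow, RingAut.one_apply]

/-- A nonzero subspace stable under a coordinatewise automorphism contains a nonzero vector
fixed by it. -/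
lemma exists_fixed_of_stable {ι : Type*} [Fintype ι] (ρ : F ≃+* F) (V : Submodule F (ι → F))
    (hV : ∀ x ∈ V, (fun s => ρ (x s)) ∈ V) (hne : V ≠ ⊥) :
    ∃ x ∈ V, x ≠ 0 ∧ ∀ s, ρ (x s) = x s := by
  classical
  have hex : ∃ k : ℕ, ∃ x ∈ V, x ≠ 0 ∧ hammingNorm x = k := by
    obtain ⟨x, hx, hx0⟩ := V.ne_bot_iff.mp hne
    exact ⟨_, x, hx, hx0, rfl⟩
  obtain ⟨x, hxV, hx0, hxk⟩ := Nat.find_spec hex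
  obtain ⟨s₀, hs₀⟩ := Function.ne_iff.mp hx0
  rw [Pi.zero_apply] at hs₀
  set y : ι → F := (x s₀)⁻¹ • x with hy
  have hyV : y ∈ V := V.smul_mem _ hxV
  have hys₀ : y s₀ = 1 := by simp [hy, hs₀]
  have hyx : hammingNorm y = hammingNorm x := hammingNorm_smul (by
    intro i; exact fun a b h => by simpa [hs₀] using h) x
  refine ⟨y, hyV, fun h => by simp [h] at hys₀, ?_⟩
  by_contra! hcon
  obtain ⟨s₁, hs₁⟩ := hcon
  refine Nat.find_min hex (m := hammingNorm ((fun s => ρ (y s)) - y)) ?_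
    ⟨_, V.sub_mem (hV y hyV) hyV, ?_, rfl⟩
  · rw [← hxk, ← hyx]
    refine Finset.card_lt_card (Finset.ssubset_iff_of_subset ?_ |>.mpr ⟨s₀, ?_, ?_⟩)
    · intro s
      simp only [Finset.mem_filter, Finset.mem_univ, true_and, Pi.sub_apply]
      exact fun h hs => h (by simp [hs])
    · simp [hys₀]
    · simp [hys₀]
  · exact Function.ne_iff.mpr ⟨s₁, by simpa [sub_eq_zero] using hs₁⟩

/-- The vectors annihilated by the rows `(σ ^ i (g s))ₛ` for `i ∈ S`. -/
def mooreKernel {k : ℕ} (σ : F ≃+* F) (g : Fin k → F) (S : Set ℤ) : Submodule F (Fin k → F) where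
  carrier := {x | ∀ i ∈ S, ∑ s, x s * (σ ^ i) (g s) = 0}
  zero_mem' := by simp
  add_mem' := by
    intro x y hx hy i hi
    simp [add_mul, Finset.sum_add_distrib, hx i hi, hy i hi]
  smul_mem' := by
    intro c x hx i hi
    simp [mul_assoc, ← Finset.mul_sum, hx i hi]

lemma mem_mooreKernel {k : ℕ} {σ : F ≃+* F} {g : Fin k → F} {S : Set ℤ} {x : Fin k → F} :
    x ∈ mooreKernel σ g S ↔ ∀ i ∈ S, ∑ s, x s * (σ ^ i) (g s) = 0 := Iff.rfl

lemma mooreKernel_anti {k : ℕ} (σ : F ≃+* F) (g : Fin k → F) {S T : Set ℤ} (h : S ⊆ T) :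
    mooreKernel σ g T ≤ mooreKernel σ g S :=
  fun _ hx i hi => hx i (h hi)

/-- Shifting the exponents corresponds to applying a power of `σ` to the vector. -/
lemma sum_zpow_mul_zpow {k : ℕ} (σ : F ≃+* F) (g x : Fin k → F) (t i : ℤ) :
    ∑ s, (σ ^ t) (x s) * (σ ^ (t + i)) (g s) = (σ ^ t) (∑ s, x s * (σ ^ i) (g s)) := by
  simp [map_sum, zpow_add_apply]

lemma mooreKernel_univ {k : ℕ} {σ : F ≃+* F} {g : Fin k → F}
    (hg : LinearIndependent (fixedField σ) g) : mooreKernel σ g Set.univ = ⊥ := by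
  by_contra hne
  obtain ⟨x, hx, hx0, hfix⟩ := exists_fixed_of_stable σ _ (fun x hx i _ => by
    have h := sum_zpow_mul_zpow σ g x 1 (i - 1)
    rw [hx _ trivial, map_zero, add_sub_cancel, zpow_one] at h
    exact h) hne
  refine hx0 (funext fun s => ?_)
  have h0 := Fintype.linearIndependent_iff.mp hg (fun s => ⟨x s, hfix s⟩) (by
    simpa [Subfield.smul_def] using hx 0 trivial) s
  exact congrArg Subtype.val h0

/-- A vector fixed by `σ ^ t` is zero as soon as it is annihilated along an arithmetic progression
of length `gcd (orderOf σ) t` whose step is coprime to the order. -/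
lemma eq_zero_of_mem_mooreKernel_of_fixed {k : ℕ} {σ : F ≃+* F} (hσ : 0 < orderOf σ)
    {g : Fin k → F} (hg : LinearIndependent (fixedField σ) g) {S : Set ℤ} {b t t1 : ℤ}
    (ht1 : Int.gcd (orderOf σ) t1 = 1)
    (hS : ∀ i : ℕ, i < Int.gcd (orderOf σ) t → b + t1 * i ∈ S) {x : Fin k → F}
    (hx : x ∈ mooreKernel σ g S) (hfix : ∀ s, (σ ^ t) (x s) = x s) : x = 0 := by
  rw [← Submodule.mem_bot F, ← mooreKernel_univ hg]
  intro z _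
  set d := Int.gcd (orderOf σ) t with hd
  have hd0 : 0 < d := Int.gcd_pos_of_ne_zero_left _ (by exact_mod_cast hσ.ne')
  have hd0' : (0 : ℤ) < d := by exact_mod_cast hd0
  have hcop : IsCoprime (d : ℤ) t1 :=
    (Int.isCoprime_iff_gcd_eq_one.mpr ht1).of_isCoprime_of_dvd_left (Int.gcd_dvd_left _ _)
  obtain ⟨u, v, huv⟩ := hcop
  obtain ⟨i, hi⟩ := Int.eq_ofNat_of_zero_le (Int.emod_nonneg (v * (z - b)) hd0'.ne')
  have hid : i < d := by
    have := Int.emod_lt_of_pos (v * (z - b)) hd0'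
    omega
  have hdiv := Int.emod_add_mul_ediv (v * (z - b)) d
  set e := v * (z - b) / d
  have hz : z = d * (u * (z - b) + t1 * e) + (b + t1 * i) := by
    rw [hi] at hdiv
    linear_combination -(z - b) * huv - t1 * hdiv
  have h := sum_zpow_mul_zpow σ g x (d * (u * (z - b) + t1 * e)) (b + t1 * i)
  rw [hx _ (hS i hid), map_zero, ← hz] at h
  simpa only [hd, zpow_gcd_mul_apply_eq_self (hfix _)] using h

/-- Along an increasing chain of exponent sets, each containing the translate by `t` of the
previous one, the dimension of the kernel drops strictly until it vanishes. -/
lemma mooreKernel_chain {k : ℕ} {σ : F ≃+* F} (hσ : 0 < orderOf σ)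
    {g : Fin k → F} (hg : LinearIndependent (fixedField σ) g) {b t t1 : ℤ}
    (ht1 : Int.gcd (orderOf σ) t1 = 1) (S : ℕ → Set ℤ) (hmono : ∀ e, S e ⊆ S (e + 1))
    (hshift : ∀ e, ∀ i ∈ S e, t + i ∈ S (e + 1))
    (hS : ∀ e, ∀ i : ℕ, i < Int.gcd (orderOf σ) t → b + t1 * i ∈ S (e + 1)) (e : ℕ) :
    mooreKernel σ g (S e) = ⊥ ∨
      Module.finrank F (mooreKernel σ g (S e)) + e ≤
        Module.finrank F (mooreKernel σ g (S 0)) := by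
  induction e with
  | zero => exact Or.inr le_rfl
  | succ e ih =>
    have hle := mooreKernel_anti σ g (hmono e)
    refine or_iff_not_imp_left.mpr fun hne => ?_
    rcases ih with h | h
    · exact absurd (le_bot_iff.mp (hle.trans h.le)) hne
    suffices hlt : mooreKernel σ g (S (e + 1)) < mooreKernel σ g (S e) by
      have := Submodule.finrank_lt_finrank_of_lt hlt
      omega
    refine lt_of_le_of_ne hle fun heq => hne ?_
    by_contra hne
    obtain ⟨x, hx, hx0, hfix⟩ := exists_fixed_of_stable (σ ^ (-t)) _ (fun x hx => by
      rw [heq]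
      intro i hi
      have h := sum_zpow_mul_zpow σ g x (-t) (t + i)
      rwa [hx _ (hshift e i hi), map_zero, neg_add_cancel_left] at h) hne
    refine hx0 (eq_zero_of_mem_mooreKernel_of_fixed hσ hg ht1 (hS e) hx fun s => ?_)
    conv_lhs => rw [← hfix s]
    rw [← zpow_add_apply, add_neg_cancel, zpow_zero, RingAut.one_apply]

/-- A vector `x` of rank weight `k` can be compressed to length `k` without changing its pairings
with the powers of `σ`. -/
lemma exists_compression {n : ℕ} (σ : F ≃+* F) {h : Fin n → F}
    (hh : LinearIndependent (fixedField σ) h) {x : Fin n → F} (hx : x ≠ 0) :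
    ∃ a g : Fin (rankWeight σ x) → F, a ≠ 0 ∧ LinearIndependent (fixedField σ) g ∧
      ∀ i : ℤ, ∑ s, a s * (σ ^ i) (g s) = ∑ j, x j * (σ ^ i) (h j) := by
  set K := fixedField σ
  set W := Submodule.span K (Set.range x)
  have : Module.Finite K W := Module.Finite.span_of_finite K (Set.finite_range x)
  let B : Module.Basis (Fin (rankWeight σ x)) K W := Module.finBasis K W
  let xw : Fin n → W := fun j => ⟨x j, Submodule.subset_span ⟨j, rfl⟩⟩
  have hxa : ∀ j, x j = ∑ s, (B.repr (xw j) s : F) * (B s : F) := fun j => by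
    have h := congrArg W.subtype (B.sum_repr (xw j))
    rw [map_sum] at h
    exact h.symm
  have hfix : ∀ (i : ℤ) (c : K), (σ ^ i) (c : F) = c := fun i c => zpow_apply_eq_self c.2 i
  refine ⟨fun s => B s, fun s => ∑ j, B.repr (xw j) s • h j, ?_, ?_, fun i => ?_⟩
  · intro h0
    refine hx (funext fun j => ?_)
    have h0' : ∀ s, (B s : F) = 0 := fun s => congrFun h0 s
    simp [hxa j, h0']
  · rw [Fintype.linearIndependent_iff]
    intro y hy s
    have hy' : ∑ j, (∑ s, y s * B.repr (xw j) s) • h j = 0 := by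
      rw [← hy]
      simp only [Finset.smul_sum, Finset.sum_smul, smul_smul]
      exact Finset.sum_comm
    have hz := Fintype.linearIndependent_iff.mp hh _ hy'
    let L : W →ₗ[K] K := ∑ s, y s • B.coord s
    have hL : ∀ w : W, L w = 0 := by
      rintro ⟨w, hw⟩
      induction hw using Submodule.span_induction with
      | mem w hw =>
        obtain ⟨j, rfl⟩ := hw
        simpa [L] using hz j
      | zero => exact map_zero L
      | add u v hu hv h1 h2 =>
        have := map_add L ⟨u, hu⟩ ⟨v, hv⟩
        rw [h1, h2, add_zero] at this
        exact this
      | smul c u hu h1 =>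
        have := map_smul L c ⟨u, hu⟩
        rw [h1, smul_zero] at this
        exact this
    simpa [L, Finsupp.single_apply] using hL (B s)
  · simp only [Subfield.smul_def, smul_eq_mul, map_sum, map_mul, hfix, hxa, Finset.mul_sum,
      Finset.sum_mul]
    rw [Finset.sum_comm]
    refine Finset.sum_congr rfl fun j _ => Finset.sum_congr rfl fun s _ => by ring

lemma rankWeight_sub_le_hammingDist [DecidableEq F] (σ : F ≃+* F) {n : ℕ} (u w : Fin n → F) :
    rankWeight σ (u - w) ≤ hammingDist u w := by
  classical
  set T := (Finset.univ.filter fun i => u i ≠ w i).image (u - w)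
  have hle : Submodule.span (fixedField σ) (Set.range (u - w)) ≤
      Submodule.span (fixedField σ) (T : Set F) := by
    rw [Submodule.span_le]
    rintro _ ⟨i, rfl⟩
    by_cases hi : u i = w i
    · simp [hi]
    · exact Submodule.subset_span (Finset.mem_coe.mpr
        (Finset.mem_image_of_mem _ (by simpa using hi)))
  have : Module.Finite (fixedField σ) (Submodule.span (fixedField σ) (T : Set F)) :=
    Module.Finite.span_of_finite _ T.finite_toSet
  calc rankWeight σ (u - w)
      ≤ Module.finrank (fixedField σ) (Submodule.span (fixedField σ) (T : Set F)) :=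
        Submodule.finrank_mono hle
    _ ≤ T.card := finrank_span_finset_le_card T
    _ ≤ hammingDist u w := Finset.card_image_le

end RankMetric

/-- **Hartmann–Tzeng bound** for the rank metric. -/
theorem hartmann_tzeng_bound {F : Type*} [Field F] [DecidableEq F]
    (σ : F ≃+* F) (m : ℕ) (hm0 : 0 < m) (hord : orderOf σ = m)
    {n : ℕ} (hn : n ≤ m) (h : Fin n → F)
    (hh : LinearIndependent (fixedField σ) h) (C : Set (Fin n → F))
    (δ r : ℕ) (b t1 t2 : ℤ) (hδ : 2 ≤ δ)
    (ht1 : Int.gcd (m : ℤ) t1 = 1) (ht2 : Int.gcd (m : ℤ) t2 < δ)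
    (hT : ∀ i j : ℕ, i ≤ δ - 2 → j ≤ r →
      b + t1 * (i : ℤ) + t2 * (j : ℤ) ∈ definingSet σ h C) :
    ∀ u ∈ C, ∀ w ∈ C, u ≠ w →
      δ + r ≤ rankWeight σ (u - w) ∧ δ + r ≤ hammingDist u w := by
  subst hord
  intro u hu w hw huw
  suffices hk : δ + r ≤ rankWeight σ (u - w) from
    ⟨hk, hk.trans (rankWeight_sub_le_hammingDist σ u w)⟩
  obtain ⟨a, g, ha, hg, hag⟩ := exists_compression σ hh (sub_ne_zero.mpr huw)
  set A : ℕ → Set ℤ := fun e => {z | ∃ i : ℕ, i < e ∧ z = b + t1 * i}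
  set B : ℕ → Set ℤ := fun e => {z | ∃ i j : ℕ, i < δ - 1 ∧ j ≤ e ∧ z = b + t1 * i + t2 * j}
  have hA := mooreKernel_chain (b := b) (t := t1) hm0 hg ht1 A
    (by rintro e _ ⟨i, hi, rfl⟩; exact ⟨i, by omega, rfl⟩)
    (by rintro e _ ⟨i, hi, rfl⟩; exact ⟨i + 1, by omega, by push_cast; ring⟩)
    (fun e i hi => ⟨i, by omega, rfl⟩) (δ - 1)
  have hB := mooreKernel_chain (b := b) (t := t2) hm0 hg ht1 B
    (by rintro e _ ⟨i, j, hi, hj, rfl⟩; exact ⟨i, j, hi, by omega, rfl⟩)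
    (by rintro e _ ⟨i, j, hi, hj, rfl⟩; exact ⟨i, j + 1, hi, by omega, by push_cast; ring⟩)
    (fun e i hi => ⟨i, 0, by omega, by omega, by simp⟩) r
  have hAB : mooreKernel σ g (B 0) = mooreKernel σ g (A (δ - 1)) := by
    congr 1
    ext z
    simp [A, B]
  have haB : a ∈ mooreKernel σ g (B r) := by
    rintro _ ⟨i, j, hi, hj, rfl⟩
    have hmem := hT i j (by omega) hj
    rw [hag]
    simp [sub_mul, Finset.sum_sub_distrib, hmem u hu, hmem w hw]
  have hBne : mooreKernel σ g (B r) ≠ ⊥ := (Submodule.ne_bot_iff _).mpr ⟨a, haB, ha⟩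
  have hBA : mooreKernel σ g (B r) ≤ mooreKernel σ g (A (δ - 1)) := by
    rw [← hAB]
    exact mooreKernel_anti σ g (by rintro _ ⟨i, j, hi, hj, rfl⟩; exact ⟨i, j, hi, by omega, rfl⟩)
  have hB' := hB.resolve_left hBne
  have hA' := hA.resolve_left fun h => hBne (le_bot_iff.mp (hBA.trans h.le))
  have hpos := Submodule.one_le_finrank_iff.mpr hBne
  have htop := Submodule.finrank_le (mooreKernel σ g (A 0))
  rw [Module.finrank_fin_fun] at htop
  rw [hAB] at hB'
  omega
end

section
/- Let F be a field and σ : F → F a field automorphism of finite order m. Let n ≤ m, let h = (h_1, …, h_n) ∈ F^n have entries linearly independent over the fixed field F^σ, and let C ⊆ F^n be any set of vectors. Suppose there exist integers δ ≥ 2, r ≥ 0, b, t1, t2, k_0 < k_1 < … < k_r with gcd(m, t1) = 1 = gcd(m, t2) and k_r − k_0 ≤ δ + r − 2, such that every integer of the form b + t1·i + t2·k_j with 0 ≤ i ≤ δ−2 and 0 ≤ j ≤ r belongs to the h-defining set T_h^σ(C). Then any two distinct elements of C are at rank distance at least δ + r; in particular they are at Hamming distance at least δ + r. -/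
/-- The Moore matrix of `x` with respect to `ρ`: its `k`-th row is `ρ ^ k` applied entrywise
to `x`. -/
def mooreMatrix {F : Type*} [Field F] (ρ : F ≃+* F) (N : ℕ) {d : ℕ} (x : Fin d → F) :
    Matrix (Fin N) (Fin d) F :=
  Matrix.of fun k l => (ρ ^ (k : ℕ)) (x l)

theorem LinearIndependent.ringEquiv_comp {F : Type*} [Field F] {K : Subfield F} {ρ : F ≃+* F}
    (hρ : ∀ a ∈ K, ρ a = a) {ι : Type*} [Fintype ι] {x : ι → F} (hx : LinearIndependent K x) :
    LinearIndependent K fun l => ρ (x l) := by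
  rw [Fintype.linearIndependent_iff] at hx ⊢
  refine fun c hc => hx c (ρ.injective ?_)
  rw [map_zero, map_sum, ← hc]
  refine Finset.sum_congr rfl fun l _ => ?_
  simp only [Subfield.smul_def, smul_eq_mul, map_mul, hρ _ (c l).2]

theorem eq_zero_of_sum_mul_pow_apply_eq_zero {F : Type*} [Field F] {K : Subfield F}
    {ρ : F ≃+* F} (hρ : ∀ a, a ∈ K ↔ ρ a = a) {d : ℕ} {x : Fin d → F}
    (hx : LinearIndependent K x) {c : Fin d → F}
    (hc : ∀ k < d, ∑ l, c l * (ρ ^ k) (x l) = 0) : c = 0 := by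
  induction d with
  | zero => exact Subsingleton.elim _ _
  | succ d ih =>
    have hx' : LinearIndependent K fun l : Fin d => x l.castSucc :=
      hx.comp _ (Fin.castSucc_injective d)
    by_cases h0 : c (Fin.last d) = 0
    · have hinit : (fun l : Fin d => c l.castSucc) = 0 := by
        refine ih hx' fun k hk => ?_
        simpa [Fin.sum_univ_castSucc, h0] using hc k (hk.trans d.lt_succ_self)
      funext l
      induction l using Fin.lastCases with
      | last => exact h0
      | cast l => exact congrFun hinit l
    · exfalso
      set a : Fin (d + 1) → F := fun l => c l / c (Fin.last d) with ha
      have ha1 : a (Fin.last d) = 1 := div_self h0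
      have hak : ∀ k < d + 1, ∑ l, a l * (ρ ^ k) (x l) = 0 := by
        intro k hk
        simp only [ha, div_mul_eq_mul_div, ← Finset.sum_div, hc k hk, zero_div]
      have hfix : (fun l : Fin d => a l.castSucc - ρ (a l.castSucc)) = 0 := by
        refine ih (hx'.ringEquiv_comp fun b hb => (hρ b).1 hb) fun k hk => ?_
        have h1 := hak (k + 1) (Nat.succ_lt_succ hk)
        have h2 := congrArg ρ (hak k (hk.trans d.lt_succ_self))
        have e1 : ∀ y, (ρ ^ (k + 1)) y = (ρ ^ k) (ρ y) := fun y => by rw [pow_succ]; rfl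
        have e2 : ∀ y, ρ ((ρ ^ k) y) = (ρ ^ k) (ρ y) := fun y => by
          rw [← e1, pow_succ']; rfl
        simp only [map_sum, map_mul, map_zero, e2] at h2
        simp only [e1] at h1
        rw [Fin.sum_univ_castSucc, ha1] at h1 h2
        rw [map_one] at h2
        simp only [sub_mul, Finset.sum_sub_distrib]
        linear_combination h1 - h2
      have hmem : ∀ l, a l ∈ K := by
        intro l
        induction l using Fin.lastCases with
        | last => rw [ha1]; exact K.one_mem
        | cast l => exact (hρ _).2 (sub_eq_zero.1 (congrFun hfix l)).symm
      have := Fintype.linearIndependent_iff.1 hx (fun l => ⟨a l, hmem l⟩)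
        (by simpa [Subfield.smul_def] using hak 0 d.succ_pos) (Fin.last d)
      exact one_ne_zero (ha1.symm.trans (congrArg Subtype.val this))

theorem isUnit_mooreMatrix {F : Type*} [Field F] {K : Subfield F}
    {ρ : F ≃+* F} (hρ : ∀ a, a ∈ K ↔ ρ a = a) {d : ℕ} {x : Fin d → F}
    (hx : LinearIndependent K x) : IsUnit (mooreMatrix ρ d x) := by
  rw [Matrix.isUnit_iff_isUnit_det, isUnit_iff_ne_zero, Ne, ← Matrix.exists_mulVec_eq_zero_iff]
  rintro ⟨c, hc0, hc⟩
  refine hc0 (eq_zero_of_sum_mul_pow_apply_eq_zero hρ hx fun k hk => ?_)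
  simpa [Matrix.mulVec, dotProduct, mooreMatrix, mul_comm] using congrFun hc ⟨k, hk⟩

theorem rank_mooreMatrix {F : Type*} [Field F] {K : Subfield F}
    {ρ : F ≃+* F} (hρ : ∀ a, a ∈ K ↔ ρ a = a) {d : ℕ} {x : Fin d → F}
    (hx : LinearIndependent K x) (N : ℕ) : (mooreMatrix ρ N x).rank = min N d := by
  have hsq := isUnit_mooreMatrix hρ hx
  rcases le_total N d with hN | hN
  · rw [min_eq_left hN]
    have hrow : LinearIndependent F (mooreMatrix ρ N x).row :=
      (Matrix.linearIndependent_rows_iff_isUnit.2 hsq).comp (Fin.castLE hN)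
        (Fin.castLE_injective hN)
    simpa using hrow.rank_matrix
  · rw [min_eq_right hN]
    refine le_antisymm (by simpa using Matrix.rank_le_card_width (mooreMatrix ρ N x)) ?_
    have h := Matrix.rank_submatrix_le (mooreMatrix ρ N x) (Fin.castLE hN) id
    have e : (mooreMatrix ρ N x).submatrix (Fin.castLE hN) id = mooreMatrix ρ d x := rfl
    rwa [e, Matrix.rank_of_isUnit _ hsq, Fintype.card_fin] at h

/-- Deleting rows lowers the rank of a matrix by at most the number of deleted rows. -/
theorem Matrix.rank_add_card_le_rank_submatrix_add_card {F m₀ m n : Type*} [Field F] [Fintype m₀]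
    [Fintype m] [Fintype n] (M : Matrix m n F) {e : m₀ → m} (he : Function.Injective e) :
    M.rank + Fintype.card m₀ ≤ (M.submatrix e id).rank + Fintype.card m := by
  classical
  set s : Finset m := Finset.univ.map ⟨e, he⟩
  have hs : sᶜ.card + Fintype.card m₀ = Fintype.card m := by
    rw [← Finset.card_compl_add_card s, Finset.card_map, Finset.card_univ]
  have hspan : Submodule.span F (Set.range M.row) ≤
      Submodule.span F (Set.range (M.submatrix e id).row) ⊔
        Submodule.span F (sᶜ.image M.row : Set (n → F)) := by
    rw [← Submodule.span_union]
    refine Submodule.span_mono ?_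
    rintro _ ⟨i, rfl⟩
    by_cases hi : i ∈ s
    · obtain ⟨j, -, rfl⟩ := Finset.mem_map.1 hi
      exact Or.inl ⟨j, rfl⟩
    · exact Or.inr (Finset.mem_coe.2 (Finset.mem_image_of_mem _ (Finset.mem_compl.2 hi)))
  have h1 := (Submodule.finrank_mono hspan).trans
    (Submodule.finrank_add_le_finrank_add_finrank _ _)
  rw [← Matrix.rank_eq_finrank_span_row, ← Matrix.rank_eq_finrank_span_row] at h1
  have h2 : Module.finrank F (Submodule.span F (sᶜ.image M.row : Set (n → F))) ≤ sᶜ.card :=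
    (finrank_span_finset_le_card _).trans Finset.card_image_le
  omega

/-- If `r + 1` of the first `δ + r - 1` Moore rows of `x` are orthogonal to the first `δ - 1` Moore
rows of `g`, then `x` and `g` have length at least `δ + r`. -/
theorem add_le_of_sum_pow_apply_mul_pow_apply_eq_zero {F : Type*} [Field F] {K : Subfield F}
    {ρ τ : F ≃+* F} (hρ : ∀ a, a ∈ K ↔ ρ a = a) (hτ : ∀ a, a ∈ K ↔ τ a = a) {d : ℕ} (hd : 0 < d)
    {x g : Fin d → F} (hx : LinearIndependent K x) (hg : LinearIndependent K g)
    {δ r : ℕ} (hδ : 2 ≤ δ) {e : Fin (r + 1) → Fin (δ + r - 1)} (he : Function.Injective e)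
    (hxg : ∀ i : Fin (δ - 1), ∀ j, ∑ l, (ρ ^ (e j : ℕ)) (x l) * (τ ^ (i : ℕ)) (g l) = 0) :
    δ + r ≤ d := by
  by_contra! hlt
  have hprod : (mooreMatrix ρ (δ + r - 1) x).submatrix e id *
      (mooreMatrix τ (δ - 1) g).transpose = 0 := by
    ext j i
    simpa [Matrix.mul_apply, mooreMatrix] using hxg i j
  have hsum := Matrix.rank_add_rank_le_card_of_mul_eq_zero hprod
  have hdel := (mooreMatrix ρ (δ + r - 1) x).rank_add_card_le_rank_submatrix_add_card he
  rw [Matrix.rank_transpose, rank_mooreMatrix hτ hg, Fintype.card_fin] at hsum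
  rw [rank_mooreMatrix hρ hx, Fintype.card_fin, Fintype.card_fin] at hdel
  rcases le_total (δ - 1) d with hle | hle
  · omega
  · have hx0 : x = 0 := by
      have := eq_zero_of_sum_mul_pow_apply_eq_zero hτ hg
        (c := fun l => (ρ ^ (e 0 : ℕ)) (x l)) fun k hk => hxg ⟨k, by omega⟩ 0
      funext l
      exact (map_eq_zero_iff _ (ρ ^ (e 0 : ℕ)).injective).1 (congrFun this l)
    exact hx.ne_zero ⟨0, hd⟩ (congrFun hx0 _)

theorem mem_fixedField {F : Type*} [Field F] {σ : F ≃+* F} {a : F} :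
    a ∈ fixedField σ ↔ σ a = a := Iff.rfl

theorem zpow_apply_of_mem_fixedField {F : Type*} [Field F] {σ : F ≃+* F} (t : ℤ) {a : F}
    (ha : a ∈ fixedField σ) : (σ ^ t) a = a :=
  (Subgroup.zpow_mem (MulAction.stabilizer (F ≃+* F) a) (x := σ) ha t :)

theorem mem_fixedField_iff_zpow_apply {F : Type*} [Field F] {σ : F ≃+* F} {t : ℤ}
    (ht : Int.gcd (orderOf σ : ℤ) t = 1) (a : F) : a ∈ fixedField σ ↔ (σ ^ t) a = a := by
  refine ⟨zpow_apply_of_mem_fixedField t, fun ha => ?_⟩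
  have hb := Int.gcd_eq_gcd_ab (orderOf σ : ℤ) t
  have hσ : (σ ^ t) ^ Int.gcdB (orderOf σ : ℤ) t = σ := by
    rw [ht, Nat.cast_one] at hb
    rw [← zpow_mul, ← one_mul (σ ^ _), ← one_zpow (Int.gcdA (orderOf σ : ℤ) t),
      ← pow_orderOf_eq_one σ, ← zpow_natCast, ← zpow_mul, ← zpow_add, ← hb, zpow_one]
  have h2 := zpow_apply_of_mem_fixedField (Int.gcdB (orderOf σ : ℤ) t) (mem_fixedField.2 ha)
  rwa [hσ] at h2

theorem rankWeight_le_hammingNorm {F : Type*} [Field F] [DecidableEq F] (σ : F ≃+* F) {n : ℕ}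
    (v : Fin n → F) : rankWeight σ v ≤ hammingNorm v := by
  have hle : Submodule.span (fixedField σ) (Set.range v) ≤
      Submodule.span (fixedField σ)
        ((Finset.univ.filter fun j => v j ≠ 0).image v : Set F) := by
    rw [Submodule.span_le]
    rintro _ ⟨j, rfl⟩
    by_cases hj : v j = 0
    · rw [hj]; exact Submodule.zero_mem _
    · exact Submodule.subset_span (by simpa using ⟨j, hj, rfl⟩)
  exact (Submodule.finrank_mono hle).trans
    ((finrank_span_finset_le_card _).trans Finset.card_image_le)

/-- Rank factorisation of a vector `v` over a subfield, transported to the side of `h`. -/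
theorem exists_linearIndependent_sum_eq {F : Type*} [Field F] (K : Subfield F) {n : ℕ}
    (v h : Fin n → F) (hh : LinearIndependent K h) :
    ∃ x g : Fin (Module.finrank K (Submodule.span K (Set.range v))) → F,
      LinearIndependent K x ∧ LinearIndependent K g ∧
        ∀ φ : F ≃+* F, (∀ a ∈ K, φ a = a) → ∑ j, v j * φ (h j) = ∑ l, x l * φ (g l) := by
  set V := Submodule.span K (Set.range v)
  have : FiniteDimensional K V := FiniteDimensional.span_of_finite K (Set.finite_range v)
  let B := Module.finBasis K V
  let w : Fin n → V := fun j => ⟨v j, Submodule.subset_span ⟨j, rfl⟩⟩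
  have hw : Submodule.span K (Set.range w) = ⊤ := by
    have : Set.range w = ((↑) : V → F) ⁻¹' Set.range v := by
      ext y
      constructor
      · rintro ⟨j, rfl⟩; exact ⟨j, rfl⟩
      · rintro ⟨j, hj⟩; exact ⟨j, Subtype.ext hj⟩
    rw [this]
    exact Submodule.span_span_coe_preimage
  refine ⟨fun l => B l, fun l => ∑ j, B.repr (w j) l • h j,
    B.linearIndependent.map' V.subtype V.ker_subtype, ?_, fun φ hφ => ?_⟩
  · rw [Fintype.linearIndependent_iff]
    intro c hc
    have hker : ∀ j, ∑ l, c l * B.repr (w j) l = 0 := by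
      refine Fintype.linearIndependent_iff.1 hh _ ?_
      rw [← hc]
      simp only [Finset.smul_sum, Finset.sum_smul, smul_smul]
      exact Finset.sum_comm
    have hzero : B.constr K c = 0 := by
      refine LinearMap.ext_on hw ?_
      rintro _ ⟨j, rfl⟩
      simpa [Module.Basis.constr_apply_fintype, mul_comm] using hker j
    intro l
    simpa using congrArg (fun f => f (B l)) hzero
  · have hv : ∀ j, v j = ∑ l, (B.repr (w j) l : F) * B l := by
      intro j
      have := congrArg ((↑) : V → F) (B.sum_repr (w j))
      rw [← show (w j : F) = v j from rfl, ← this, AddSubmonoidClass.coe_finsetSum]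
      rfl
    simp only [Subfield.smul_def, smul_eq_mul, map_sum, map_mul, hφ _ (Subtype.prop _)]
    conv_lhs => enter [2, j]; rw [hv j, Finset.sum_mul]
    rw [Finset.sum_comm]
    refine Finset.sum_congr rfl fun l _ => ?_
    rw [Finset.mul_sum]
    exact Finset.sum_congr rfl fun j _ => by ring

/-- **Roos bound** for the rank metric. -/
theorem roos_bound {F : Type*} [Field F] [DecidableEq F]
    (σ : F ≃+* F) (m : ℕ) (hm0 : 0 < m) (hord : orderOf σ = m)
    {n : ℕ} (hn : n ≤ m) (h : Fin n → F)
    (hh : LinearIndependent (fixedField σ) h) (C : Set (Fin n → F))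
    (δ r : ℕ) (b t1 t2 : ℤ) (hδ : 2 ≤ δ)
    (ht1 : Int.gcd (m : ℤ) t1 = 1) (ht2 : Int.gcd (m : ℤ) t2 = 1)
    (k : Fin (r + 1) → ℤ) (hk : StrictMono k)
    (hkrange : k (Fin.last r) - k 0 ≤ (δ : ℤ) + (r : ℤ) - 2)
    (hT : ∀ i : ℕ, i ≤ δ - 2 → ∀ j : Fin (r + 1),
      b + t1 * (i : ℤ) + t2 * k j ∈ definingSet σ h C) :
    ∀ u ∈ C, ∀ w ∈ C, u ≠ w →
      δ + r ≤ rankWeight σ (u - w) ∧ δ + r ≤ hammingDist u w := by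
  intro u hu w hw huw
  suffices hrank : δ + r ≤ rankWeight σ (u - w) by
    refine ⟨hrank, hrank.trans ?_⟩
    rw [hammingDist_comm, hammingDist_eq_hammingNorm, neg_add_eq_sub]
    exact rankWeight_le_hammingNorm σ (u - w)
  subst hord
  obtain ⟨x, g, hx, hg, hxg⟩ := exists_linearIndependent_sum_eq (fixedField σ) (u - w) h hh
  have hsum : ∀ i : ℕ, i ≤ δ - 2 → ∀ j,
      ∑ l, x l * (σ ^ (b + t1 * (i : ℤ) + t2 * k j)) (g l) = 0 := by
    intro i hi j
    rw [← hxg _ fun a ha => zpow_apply_of_mem_fixedField _ ha]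
    simp only [Pi.sub_apply, sub_mul, Finset.sum_sub_distrib]
    rw [hT i hi j u hu, hT i hi j w hw, sub_zero]
  have hbound : ∀ j, k (Fin.last r) - k j ≤ (δ : ℤ) + r - 2 := fun j =>
    (sub_le_sub_left (hk.monotone (Fin.zero_le j)) _).trans hkrange
  have hnonneg : ∀ j, 0 ≤ k (Fin.last r) - k j := fun j =>
    sub_nonneg.2 (hk.monotone (Fin.le_last j))
  have hpos : 0 < rankWeight σ (u - w) := by
    obtain ⟨j, hj⟩ := Function.ne_iff.1 (sub_ne_zero.2 huw)
    have : FiniteDimensional (fixedField σ)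
        (Submodule.span (fixedField σ) (Set.range (u - w))) :=
      FiniteDimensional.span_of_finite _ (Set.finite_range _)
    refine Module.finrank_pos_iff_exists_ne_zero.2
      ⟨⟨(u - w) j, Submodule.subset_span ⟨j, rfl⟩⟩, fun h0 => hj (congrArg Subtype.val h0)⟩
  have hcomp : ∀ (s t : ℤ) (y : F), (σ ^ s) ((σ ^ t) y) = (σ ^ (s + t)) y := by
    intro s t y
    rw [zpow_add]
    rfl
  refine add_le_of_sum_pow_apply_mul_pow_apply_eq_zero (ρ := σ ^ t2) (τ := σ ^ t1)
    (mem_fixedField_iff_zpow_apply ht2) (mem_fixedField_iff_zpow_apply ht1) hpos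
    (hx.ringEquiv_comp (ρ := σ ^ (-(t2 * k (Fin.last r))))
      fun a ha => zpow_apply_of_mem_fixedField _ ha)
    (hg.ringEquiv_comp (ρ := σ ^ b) fun a ha => zpow_apply_of_mem_fixedField _ ha) hδ
    (e := fun j => ⟨(k (Fin.last r) - k j).toNat, by have := hbound j; omega⟩) ?_ ?_
  · intro j j' hjj'
    have h1 : (k (Fin.last r) - k j).toNat = (k (Fin.last r) - k j').toNat :=
      congrArg Fin.val hjj'
    have h2 := hnonneg j
    have h3 := hnonneg j'
    exact hk.injective (by omega)
  · intro i j
    have h1 := congrArg (σ ^ (-(t2 * k j))) (hsum i (by omega) j)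
    rw [map_sum, map_zero] at h1
    rw [← h1]
    refine Finset.sum_congr rfl fun l _ => ?_
    simp only [map_mul, ← zpow_natCast, ← zpow_mul, hcomp, Int.toNat_of_nonneg (hnonneg j)]
    ring_nf
end

section
/- Let K ⊆ F be a field extension, τ : K → K a field automorphism, and s^{(0)}, …, s^{(L−1)} sequences of length N with entries in K. Let v = (v_0, …, v_ℓ) ∈ K^{ℓ+1} be a τ-SFSR of length ℓ for all these sequences. Then the following are equivalent: (a) every τ-SFSR with entries in K for the L sequences has length at least ℓ, and every τ-SFSR with entries in K of length exactly ℓ for them is a nonzero K-scalar multiple of v; (b) every τ-SFSR with entries in F for the L sequences has length at least ℓ, and every τ-SFSR with entries in F of length exactly ℓ for them is a nonzero F-scalar multiple of v. -/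
/-- `v` is a `τ`-skew-feedback shift register of length `ℓ` (with entries in `F`, an
extension of `K`) for the `L` sequences `s 0, …, s (L-1)` of length `N` with entries
in `K`. -/
def IsSFSR {K F : Type*} [Field K] [Field F] [Algebra K F] (τ : K ≃+* K)
    (L N : ℕ) (s : Fin L → ℕ → K) (ℓ : ℕ) (v : Fin (ℓ + 1) → F) : Prop :=
  v 0 ≠ 0 ∧ ∀ j : Fin L, ∀ n : ℕ, ℓ ≤ n → n < N →
    ∑ i : Fin (ℓ + 1), v i * algebraMap K F ((τ ^ (i : ℕ)) (s j (n - (i : ℕ)))) = 0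

section

variable {K F : Type*} [Field K] [Field F] [Algebra K F]

theorem LinearMap.sum_apply_mul_eq_zero {ι : Type*} [Fintype ι] (f : F →ₗ[K] K) (w : ι → F)
    (a : ι → K) (h : ∑ i, w i * algebraMap K F (a i) = 0) :
    ∑ i, f (w i) * a i = 0 := by
  have hf := congrArg f h
  simpa only [map_sum, map_zero, mul_comm (w _), ← Algebra.smul_def, map_smul, smul_eq_mul,
    mul_comm (a _)] using hf

theorem IsSFSR.comp_linearMap {τ : K ≃+* K} {L N ℓ : ℕ} {s : Fin L → ℕ → K}
    {w : Fin (ℓ + 1) → F} (hw : IsSFSR τ L N s ℓ w) (f : F →ₗ[K] K) (h0 : f (w 0) ≠ 0) :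
    IsSFSR τ L N s ℓ fun i => f (w i) :=
  ⟨h0, fun j n hn hN => f.sum_apply_mul_eq_zero w _ (hw.2 j n hn hN)⟩

theorem IsSFSR.algebraMap_comp {τ : K ≃+* K} {L N ℓ : ℕ} {s : Fin L → ℕ → K}
    {w : Fin (ℓ + 1) → K} (hw : IsSFSR τ L N s ℓ w) :
    IsSFSR τ L N s ℓ fun i => algebraMap K F (w i) := by
  refine ⟨(map_ne_zero _).2 hw.1, fun j n hn hN => ?_⟩
  have h := congrArg (algebraMap K F) (hw.2 j n hn hN)
  simpa only [map_sum, map_mul, map_zero, Algebra.algebraMap_self, RingHom.id_apply] using h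

end

/-- Being "the" (up to nonzero scalars) shortest skew-feedback shift register for a family
of sequences does not depend on the field one works over. -/
theorem sfsr_unique_shortest_iff_over_extension {K F : Type*} [Field K] [Field F]
    [Algebra K F] (τ : K ≃+* K) (L N ℓ : ℕ) (s : Fin L → ℕ → K)
    (v : Fin (ℓ + 1) → K) (hv : IsSFSR τ L N s ℓ v) :
    ((∀ (ℓ' : ℕ) (w : Fin (ℓ' + 1) → K), IsSFSR τ L N s ℓ' w → ℓ ≤ ℓ') ∧
      (∀ w : Fin (ℓ + 1) → K, IsSFSR τ L N s ℓ w → ∃ c : K, c ≠ 0 ∧ w = c • v))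
    ↔
    ((∀ (ℓ' : ℕ) (w : Fin (ℓ' + 1) → F), IsSFSR τ L N s ℓ' w → ℓ ≤ ℓ') ∧
      (∀ w : Fin (ℓ + 1) → F, IsSFSR τ L N s ℓ w →
        ∃ c : F, c ≠ 0 ∧ w = c • fun i => algebraMap K F (v i))) := by
  have hv0 := hv.1
  have hvF : algebraMap K F (v 0) ≠ 0 := (map_ne_zero _).2 hv0
  constructor
  · rintro ⟨hmin, huniq⟩
    refine ⟨fun ℓ' w hw => ?_, fun w hw => ?_⟩
    · obtain ⟨f, hf⟩ : ∃ f : Module.Dual K F, f (w 0) ≠ 0 := by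
        by_contra! h
        exact hw.1 ((Module.forall_dual_apply_eq_zero_iff K _).1 h)
      exact hmin ℓ' _ (hw.comp_linearMap f hf)
    · refine ⟨w 0 / algebraMap K F (v 0), div_ne_zero hw.1 hvF, ?_⟩
      set c := w 0 / algebraMap K F (v 0) with hc
      have hu0 : w 0 - c * algebraMap K F (v 0) = 0 := by
        rw [hc, div_mul_cancel₀ _ hvF, sub_self]
      have hdual (f : Module.Dual K F) (i : Fin (ℓ + 1)) :
          f (w i - c * algebraMap K F (v i)) = 0 := by
        have hsum : IsSFSR τ L N s ℓ fun i => v i + f (w i - c * algebraMap K F (v i)) := by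
          refine ⟨by simpa [hu0] using hv0, fun j n hn hN => ?_⟩
          have hu := f.sum_apply_mul_eq_zero (fun i => w i - c * algebraMap K F (v i))
            (fun i => (τ ^ (i : ℕ)) (s j (n - (i : ℕ)))) (by
              simp only [sub_mul, Finset.sum_sub_distrib, mul_assoc, ← Finset.mul_sum]
              rw [hw.2 j n hn hN, (hv.algebraMap_comp (F := F)).2 j n hn hN, mul_zero, sub_zero])
          simp only [add_mul, Finset.sum_add_distrib]
          rw [hv.2 j n hn hN, zero_add]
          exact hu
        obtain ⟨d, -, hd⟩ := huniq _ hsum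
        have hd1 : d = 1 := by
          have h := congrFun hd 0
          simp only [hu0, map_zero, add_zero, Pi.smul_apply, smul_eq_mul] at h
          exact (mul_eq_right₀ hv0).1 h.symm
        simpa [hd1] using congrFun hd i
      funext i
      exact sub_eq_zero.1 ((Module.forall_dual_apply_eq_zero_iff K _).1 fun f => hdual f i)
  · rintro ⟨hmin, huniq⟩
    refine ⟨fun ℓ' w hw => hmin ℓ' _ hw.algebraMap_comp, fun w hw => ?_⟩
    obtain ⟨c, -, hc⟩ := huniq _ hw.algebraMap_comp
    have hc' (i : Fin (ℓ + 1)) : algebraMap K F (w i) = c * algebraMap K F (v i) :=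
      congrFun hc i
    refine ⟨w 0 / v 0, div_ne_zero hw.1 hv0, funext fun i => (algebraMap K F).injective ?_⟩
    rw [Pi.smul_apply, smul_eq_mul, map_mul, map_div₀, hc' 0, mul_div_cancel_right₀ _ hvF, hc' i]
end

section
/- Let F be a field, σ : F → F a field automorphism of finite order m, and t an integer with gcd(m, t) = 1. Let ε_1, …, ε_ν ∈ F be linearly independent over the fixed field F^σ. Then there exists exactly one vector (ς_0, …, ς_ν) ∈ F^{ν+1} with ς_ν = 1 satisfying Σ_{l=0}^ν ς_l·σ^{t·l}(ε_k) = 0 for every 1 ≤ k ≤ ν; moreover this vector has ς_0 ≠ 0. -/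
theorem fixedField_le_fixedField_zpow {F : Type*} [Field F] (σ : F ≃+* F) (n : ℤ) :
    fixedField σ ≤ fixedField (σ ^ n) := fun x hx =>
  zpow_mem (K := MulAction.stabilizer (RingAut F) x) (x := σ) hx n

theorem fixedField_zpow_eq {F : Type*} [Field F] (σ : F ≃+* F) (t : ℤ)
    (ht : Int.gcd (orderOf σ : ℤ) t = 1) : fixedField (σ ^ t) = fixedField σ := by
  refine le_antisymm ?_ (fixedField_le_fixedField_zpow σ t)
  have h := fixedField_le_fixedField_zpow (σ ^ t) (Int.gcdB (orderOf σ) t)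
  have hbezout := Int.gcd_eq_gcd_ab (orderOf σ) t
  rw [ht, Nat.cast_one] at hbezout
  have hσ : (σ ^ t) ^ Int.gcdB (orderOf σ) t = σ := by
    calc (σ ^ t) ^ Int.gcdB (orderOf σ) t
        = σ ^ ((orderOf σ : ℤ) * Int.gcdA (orderOf σ) t + t * Int.gcdB (orderOf σ) t) := by
          rw [zpow_add, zpow_mul, zpow_natCast, pow_orderOf_eq_one, one_zpow, one_mul, zpow_mul]
      _ = σ := by rw [← hbezout, zpow_one]
  rwa [hσ] at h

/-- The rows of a Moore matrix with linearly independent generators are linearly independent. -/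
theorem eq_zero_of_sum_mul_pow_apply_eq_zero_s9 {F : Type*} [Field F] (τ : F ≃+* F) :
    ∀ (n : ℕ) (ε : Fin n → F), LinearIndependent (fixedField τ) ε → ∀ a : Fin n → F,
      (∀ l < n, ∑ k, a k * (τ ^ l) (ε k) = 0) → a = 0 := by
  intro n
  induction n with
  | zero => intro ε _ a _; exact Subsingleton.elim _ _
  | succ n ih =>
    intro ε hε a ha
    have htail : LinearIndependent (fixedField τ) fun k : Fin n => ε k.succ :=
      hε.comp Fin.succ (Fin.succ_injective n)
    by_cases h0 : a 0 = 0
    · have h := ih _ htail (fun k => a k.succ) fun l hl => by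
        simpa [Fin.sum_univ_succ, h0] using ha l (hl.trans n.lt_succ_self)
      funext k
      exact Fin.cases h0 (fun k => congrFun h k) k
    · exfalso
      let b : Fin (n + 1) → F := fun k => (a 0)⁻¹ * a k
      have hb0 : b 0 = 1 := inv_mul_cancel₀ h0
      have hb : ∀ l < n + 1, ∑ k, b k * (τ ^ l) (ε k) = 0 := fun l hl => by
        simp only [b, mul_assoc, ← Finset.mul_sum, ha l hl, mul_zero]
      have hdiff := ih _ htail (fun k => τ.symm (b k.succ) - b k.succ) fun l hl => by
        have h1 := congrArg τ.symm (hb (l + 1) (Nat.succ_lt_succ hl))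
        have h2 := hb l (hl.trans n.lt_succ_self)
        simp only [map_sum, map_mul, map_zero, pow_succ', RingAut.mul_apply,
          RingEquiv.symm_apply_apply] at h1
        rw [Fin.sum_univ_succ, hb0] at h1 h2
        simp only [sub_mul, Finset.sum_sub_distrib]
        rw [map_one] at h1
        linear_combination h1 - h2
      have hfix : ∀ k, b k ∈ fixedField τ := by
        intro k
        change τ (b k) = b k
        refine Fin.cases (by rw [hb0, map_one]) (fun k => ?_) k
        have h := sub_eq_zero.mp (congrFun hdiff k)
        exact ((RingEquiv.symm_apply_eq τ).mp h).symm
      have h := Fintype.linearIndependent_iff.mp hε (fun k => ⟨b k, hfix k⟩)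
        (by simpa [Subfield.smul_def] using hb 0 n.succ_pos) 0
      exact one_ne_zero (hb0.symm.trans (congrArg Subtype.val h))

theorem isUnit_moore_matrix {F : Type*} [Field F] (τ : F ≃+* F) {n : ℕ} (ε : Fin n → F)
    (hε : LinearIndependent (fixedField τ) ε) :
    IsUnit (Matrix.of fun k l : Fin n => (τ ^ (l : ℕ)) (ε k)) := by
  rw [← Matrix.vecMul_injective_iff_isUnit, ← Matrix.coe_vecMulLinear,
    injective_iff_map_eq_zero]
  intro a ha
  exact eq_zero_of_sum_mul_pow_apply_eq_zero_s9 τ n ε hε a fun l hl => congrFun ha ⟨l, hl⟩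

/-- Existence and uniqueness of the (coefficient vector of the) error span polynomial,
which moreover has nonzero constant coefficient. -/
theorem error_span_polynomial_exists_unique {F : Type*} [Field F]
    (σ : F ≃+* F) (m : ℕ) (hm0 : 0 < m) (hord : orderOf σ = m)
    (t : ℤ) (ht : Int.gcd (m : ℤ) t = 1) (ν : ℕ) (ε : Fin ν → F)
    (hε : LinearIndependent (fixedField σ) ε) :
    ∃ ς : Fin (ν + 1) → F,
      (ς (Fin.last ν) = 1 ∧
        (∀ k, ∑ l : Fin (ν + 1), ς l * (σ ^ (t * ((l : ℕ) : ℤ))) (ε k) = 0) ∧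
        ς 0 ≠ 0) ∧
      ∀ ς' : Fin (ν + 1) → F, ς' (Fin.last ν) = 1 →
        (∀ k, ∑ l : Fin (ν + 1), ς' l * (σ ^ (t * ((l : ℕ) : ℤ))) (ε k) = 0) → ς' = ς := by
  subst hord
  rw [← fixedField_zpow_eq σ t ht] at hε
  simp only [zpow_mul, zpow_natCast]
  generalize σ ^ t = τ at hε ⊢
  have hM := isUnit_moore_matrix τ ε hε
  have hinj := Matrix.mulVec_injective_iff_isUnit.mpr hM
  obtain ⟨c, hc⟩ := Matrix.mulVec_surjective_iff_isUnit.mpr hM fun k => -(τ ^ ν) (ε k)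
  have hroot : ∀ k, ∑ l : Fin (ν + 1), (Fin.snoc c 1 : Fin (ν + 1) → F) l *
      (τ ^ (l : ℕ)) (ε k) = 0 := fun k => by
    have h := congrFun hc k
    simp only [Matrix.mulVec, dotProduct, Matrix.of_apply] at h
    simp only [Fin.sum_univ_castSucc, Fin.snoc_castSucc, Fin.snoc_last, Fin.val_castSucc,
      Fin.val_last, mul_comm (c _), h, one_mul, neg_add_cancel]
  refine ⟨Fin.snoc c 1, ⟨Fin.snoc_last _ _, hroot, fun h0 => ?_⟩, fun d hd hdroot => ?_⟩
  · generalize hς : (Fin.snoc c 1 : Fin (ν + 1) → F) = ς at hroot h0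
    have hlast : ς (Fin.last ν) = 1 := by rw [← hς, Fin.snoc_last]
    have hzero : (fun l : Fin ν => τ.symm (ς l.succ)) = 0 := by
      refine hinj (funext fun k => ?_)
      have h := congrArg τ.symm (hroot k)
      rw [Fin.sum_univ_succ, h0, zero_mul, zero_add] at h
      simpa [Matrix.mulVec, dotProduct, pow_succ', RingAut.mul_apply, mul_comm] using h
    have hς0 : ∀ l, ς l = 0 := fun l =>
      Fin.cases h0 (fun l => (map_eq_zero_iff τ.symm τ.symm.injective).mp (congrFun hzero l)) l
    exact one_ne_zero (hlast.symm.trans (hς0 _))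
  · have hinit : Fin.init d = c := by
      refine hinj (hc.symm ▸ funext fun k => ?_)
      have h := hdroot k
      rw [Fin.sum_univ_castSucc, hd, one_mul] at h
      simpa [Matrix.mulVec, dotProduct, Fin.init, mul_comm] using eq_neg_of_add_eq_zero_left h
    rw [← Fin.snoc_init_self d, hinit, hd]
end

section
/- Let F be a field, σ : F → F a field automorphism, and b, t1, t2, δ ≥ 2, r ≥ 0 integers, with further integers k_0, …, k_r. Suppose ε = (ε_1,…,ε_ν), η = (η_1,…,η_ν) ∈ F^ν and elements s_i^{(j)} ∈ F satisfy s_i^{(j)} = Σ_{k=1}^ν ε_k·σ^{b + t1·i + t2·k_j}(η_k) for all 0 ≤ i ≤ δ−2 and 0 ≤ j ≤ r, and suppose ς = (ς_0, …, ς_ν) ∈ F^{ν+1} satisfies Σ_{l=0}^ν ς_l·σ^{t1·l}(ε_k) = 0 for every 1 ≤ k ≤ ν. Then Σ_{l=0}^ν ς_l·σ^{t1·l}(s_{i−l}^{(j)}) = 0 for every ν ≤ i ≤ δ−2 and every 0 ≤ j ≤ r; in other words, if moreover ς_0 ≠ 0, then ς is a σ^{t1}-SFSR of length ν for each of the r+1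 sequences (s_0^{(j)}, …, s_{δ−2}^{(j)}). -/
/-- **Key equations with an error span polynomial**: the coefficient vector of the error
span polynomial satisfies the recurrence of a `σ^t1`-skew-feedback shift register for the
`r+1` sequences of syndromes. -/
theorem key_equations_error_span {F : Type*} [Field F] (σ : F ≃+* F)
    (b t1 t2 : ℤ) (δ r ν : ℕ) (hδ : 2 ≤ δ)
    (k : Fin (r + 1) → ℤ) (ε η : Fin ν → F) (s : Fin (r + 1) → ℕ → F)
    (hs : ∀ j : Fin (r + 1), ∀ i : ℕ, i ≤ δ - 2 →
      s j i = ∑ k', ε k' * (σ ^ (b + t1 * (i : ℤ) + t2 * k j)) (η k'))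
    (ς : Fin (ν + 1) → F)
    (hς : ∀ k', ∑ l : Fin (ν + 1), ς l * (σ ^ (t1 * ((l : ℕ) : ℤ))) (ε k') = 0) :
    ∀ i : ℕ, ν ≤ i → i ≤ δ - 2 → ∀ j : Fin (r + 1),
      ∑ l : Fin (ν + 1), ς l * (σ ^ (t1 * ((l : ℕ) : ℤ))) (s j (i - (l : ℕ))) = 0 := by
  intro i hνi hiδ j
  have expand : ∀ l : Fin (ν + 1),
      ς l * (σ ^ (t1 * ((l : ℕ) : ℤ))) (s j (i - (l : ℕ))) =
        ∑ k', ς l * (σ ^ (t1 * ((l : ℕ) : ℤ))) (ε k') *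
          (σ ^ (b + t1 * (i : ℤ) + t2 * k j)) (η k') := by
    intro l
    have hl : (l : ℕ) ≤ i := by omega
    rw [hs j (i - l) (by omega), map_sum, Finset.mul_sum]
    refine Finset.sum_congr rfl fun k' _ => ?_
    rw [map_mul, ← RingAut.mul_apply, ← zpow_add, mul_assoc, Nat.cast_sub hl]
    congr 4
    ring
  simp_rw [expand]
  rw [Finset.sum_comm]
  simp_rw [← Finset.sum_mul, hς, zero_mul, Finset.sum_const_zero]
end

section
/- Let F be a field, σ : F → F a field automorphism, and b, t1, t2, δ ≥ 2, r ≥ 0 integers, with further integers k_0, …, k_r. Suppose ε = (ε_1,…,ε_ν), η = (η_1,…,η_ν) ∈ F^ν and elements s̃_i^{(j)} ∈ F satisfy s̃_i^{(j)} = Σ_{k=1}^ν η_k·σ^{−b − t1·i − t2·k_j}(ε_k) for all 0 ≤ i ≤ δ−2 and 0 ≤ j ≤ r, and suppose λ = (λ_0, …, λ_ν) ∈ F^{ν+1} satisfies Σ_{l=0}^ν λ_l·σ^{−t1·l}(η_k) = 0 for every 1 ≤ k ≤ ν. Then Σ_{l=0}^ν λ_l·σ^{−t1·l}(s̃_{i−l}^{(j)})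 = 0 for every ν ≤ i ≤ δ−2 and every 0 ≤ j ≤ r; in other words, if moreover λ_0 ≠ 0, then λ is a σ^{−t1}-SFSR of length ν for each of the r+1 sequences (s̃_0^{(j)}, …, s̃_{δ−2}^{(j)}). -/
/-- **Key equations with an error locator polynomial**: the coefficient vector of the error
locator polynomial satisfies the recurrence of a `σ^{-t1}`-skew-feedback shift register for
the `r+1` sequences of twisted syndromes. -/
theorem key_equations_error_locator {F : Type*} [Field F] (σ : F ≃+* F)
    (b t1 t2 : ℤ) (δ r ν : ℕ) (hδ : 2 ≤ δ)
    (k : Fin (r + 1) → ℤ) (ε η : Fin ν → F) (st : Fin (r + 1) → ℕ → F)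
    (hst : ∀ j : Fin (r + 1), ∀ i : ℕ, i ≤ δ - 2 →
      st j i = ∑ k', η k' * (σ ^ (-(b + t1 * (i : ℤ) + t2 * k j))) (ε k'))
    (lc : Fin (ν + 1) → F)
    (hlc : ∀ k', ∑ l : Fin (ν + 1), lc l * (σ ^ (-(t1 * ((l : ℕ) : ℤ)))) (η k') = 0) :
    ∀ i : ℕ, ν ≤ i → i ≤ δ - 2 → ∀ j : Fin (r + 1),
      ∑ l : Fin (ν + 1), lc l * (σ ^ (-(t1 * ((l : ℕ) : ℤ)))) (st j (i - (l : ℕ))) = 0 := by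
  intro i hνi hi j
  have twisted_syndrome (l : Fin (ν + 1)) :
      (σ ^ (-(t1 * ((l : ℕ) : ℤ)))) (st j (i - (l : ℕ))) =
        ∑ k', (σ ^ (-(t1 * ((l : ℕ) : ℤ)))) (η k') *
          (σ ^ (-(b + t1 * (i : ℤ) + t2 * k j))) (ε k') := by
    have hl : (l : ℕ) ≤ i := by omega
    rw [hst j _ (by omega), map_sum]
    refine Finset.sum_congr rfl fun k' _ => ?_
    rw [map_mul, ← RingAut.mul_apply, ← zpow_add, Nat.cast_sub hl]
    congr 3
    ring
  simp_rw [twisted_syndrome, Finset.mul_sum]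
  rw [Finset.sum_comm]
  refine Finset.sum_eq_zero fun k' _ => ?_
  simp_rw [← mul_assoc]
  rw [← Finset.sum_mul, hlc, zero_mul]
end
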